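/- Let T ≥ 1, I a finite index set, f_i : ℝ^T → ℝ twice differentiable and strictly convex for each i ∈ I, and g : ℝ^T → ℝ strictly convex and differentiable. For each p ∈ ℝ^T and i ∈ I, let x*_i(p) ∈ ℝ^T be the unique minimizer of y ↦ f_i(y) + ⟨p, y⟩, and suppose each x*_i is decreasing in the monotone-operator sense (⟨x*_i(p) − x*_i(q), p − q⟩ ≤ 0 for all p, q). Let p* ∈ ℝ^T satisfy ∇g(Σ_i x*_i(p*)) = p*, and let p : ℝ → ℝ^T be differentiable with p'(t) = ∇g(Σ_i x*_i(p(t))) − p(t) for all t ≥ 0. Then p(t) → p* as t → ∞. -/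

import Mathlib

open Filter Finset RealInnerProductSpace

section Convex

variable {E : Type*} [NormedAddCommGroup E]

/-- A continuous convex function with a strict global minimizer grows at least linearly away from
that minimizer. -/
theorem ConvexOn.exists_linear_growth [NormedSpace ℝ E] [FiniteDimensional ℝ E]
    {h : E → ℝ} {x₀ : E} (hconv : ConvexOn ℝ Set.univ h) (hcont : Continuous h)
    (hmin : ∀ y, y ≠ x₀ → h x₀ < h y) {ε : ℝ} (hε : 0 < ε) :
    ∃ c > 0, ∀ y, ε ≤ ‖y - x₀‖ → c * ‖y - x₀‖ ≤ h y - h x₀ := by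
  obtain ⟨δ, hδ, hsphere⟩ : ∃ δ > 0, ∀ z ∈ Metric.sphere x₀ ε, δ ≤ h z - h x₀ := by
    rcases (Metric.sphere x₀ ε).eq_empty_or_nonempty with hemp | hne
    · exact ⟨1, one_pos, by simp [hemp]⟩
    · obtain ⟨z, hz, hzmin⟩ := (isCompact_sphere x₀ ε).exists_isMinOn hne hcont.continuousOn
      refine ⟨h z - h x₀, sub_pos.2 (hmin z (Metric.ne_of_mem_sphere hz hε.ne')), ?_⟩
      exact fun w hw => sub_le_sub_right (hzmin hw) _
  refine ⟨δ / ε, div_pos hδ hε, fun y hy => ?_⟩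
  have hr : 0 < ‖y - x₀‖ := hε.trans_le hy
  set s := ε / ‖y - x₀‖ with hs
  have hs0 : 0 < s := div_pos hε hr
  have hs1 : s ≤ 1 := (div_le_one hr).2 hy
  have hmem : (1 - s) • x₀ + s • y ∈ Metric.sphere x₀ ε := by
    have : (1 - s) • x₀ + s • y - x₀ = s • (y - x₀) := by module
    rw [mem_sphere_iff_norm, this, norm_smul, Real.norm_of_nonneg hs0.le, hs,
      div_mul_cancel₀ _ hr.ne']
  have hle := hconv.2 (Set.mem_univ x₀) (Set.mem_univ y) (sub_nonneg.2 hs1) hs0.le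
    (sub_add_cancel 1 s)
  simp only [smul_eq_mul] at hle
  have hδs : δ ≤ s * (h y - h x₀) := by linarith [hsphere _ hmem]
  calc δ / ε * ‖y - x₀‖ = δ / s := by rw [hs]; field_simp
    _ ≤ h y - h x₀ := (div_le_iff₀' hs0).2 hδs

variable [InnerProductSpace ℝ E]

/-- The first-order characterization of convexity. -/
theorem ConvexOn.inner_gradient_le [CompleteSpace E] {g : E → ℝ}
    (hg : ConvexOn ℝ Set.univ g) (hd : Differentiable ℝ g) (x y : E) :
    ⟪gradient g x, y - x⟫ ≤ g y - g x := by
  have hline : ConvexOn ℝ Set.univ (g ∘ AffineMap.lineMap (k := ℝ) x y) := by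
    simpa using hg.comp_affineMap (AffineMap.lineMap (k := ℝ) x y)
  have hderiv : HasDerivAt (g ∘ AffineMap.lineMap (k := ℝ) x y) ⟪gradient g x, y - x⟫ 0 := by
    rw [inner_gradient_left]
    exact (hd x).hasFDerivAt.comp_hasDerivAt_of_eq 0 AffineMap.hasDerivAt_lineMap (by simp)
  simpa [slope_def_field] using
    hline.le_slope_of_hasDerivAt (Set.mem_univ 0) (Set.mem_univ 1) one_pos hderiv

theorem ConvexOn.inner_gradient_sub_nonneg [CompleteSpace E] {g : E → ℝ}
    (hg : ConvexOn ℝ Set.univ g) (hd : Differentiable ℝ g) (x y : E) :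
    0 ≤ ⟪x - y, gradient g x - gradient g y⟫ := by
  have h₁ := hg.inner_gradient_le hd x y
  have h₂ := hg.inner_gradient_le hd y x
  rw [real_inner_comm]
  simp only [inner_sub_left, inner_sub_right] at *
  linarith

end Convex

section BestResponse

variable {E : Type*} [NormedAddCommGroup E] [InnerProductSpace ℝ E] {f : E → ℝ} {x : E → E}

theorem continuous_of_isStrictMinimizer [FiniteDimensional ℝ E]
    (hconv : ConvexOn ℝ Set.univ f) (hcont : Continuous f)
    (hmin : ∀ q y, y ≠ x q → f (x q) + ⟪q, x q⟫ < f y + ⟪q, y⟫) : Continuous x := by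
  refine continuous_iff_continuousAt.2 fun q => Metric.continuousAt_iff.2 fun ε hε => ?_
  have hlin : ConvexOn ℝ Set.univ fun y => ⟪q, y⟫ := (innerₛₗ ℝ q).convexOn convex_univ
  obtain ⟨c, hc, hgrow⟩ := (hconv.add hlin).exists_linear_growth
    (hcont.add (by fun_prop)) (hmin q) hε
  refine ⟨c, hc, fun r hr => ?_⟩
  by_contra! hfar
  rw [dist_eq_norm] at hr hfar
  have hle : f (x r) + ⟪r, x r⟫ ≤ f (x q) + ⟪r, x q⟫ := by
    rcases eq_or_ne (x q) (x r) with he | hne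
    · rw [he]
    · exact (hmin r _ hne).le
  have hg := hgrow _ hfar
  have hcs := real_inner_le_norm (q - r) (x r - x q)
  have hlt := mul_lt_mul_of_pos_right hr (hε.trans_le hfar)
  rw [norm_sub_rev q r] at hcs
  simp only [Pi.add_apply, inner_sub_left, inner_sub_right] at hg hcs
  linarith

/-- Envelope theorem: the gradient of the optimal value is the minimizer. -/
theorem hasGradientAt_optimalValue [CompleteSpace E] (hx : Continuous x)
    (hmin : ∀ q y, f (x q) + ⟪q, x q⟫ ≤ f y + ⟪q, y⟫) (q : E) :
    HasGradientAt (fun r => f (x r) + ⟪r, x r⟫) (x q) q := by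
  rw [hasGradientAt_iff_isLittleO, Asymptotics.isLittleO_iff]
  intro c hc
  filter_upwards [Metric.continuousAt_iff'.1 hx.continuousAt c hc] with r hr
  rw [dist_eq_norm] at hr
  have hup := hmin r (x q)
  have hlow := hmin q (x r)
  have hcs := neg_le_of_abs_le (abs_real_inner_le_norm (x r - x q) (r - q))
  have hmul := mul_le_mul_of_nonneg_right hr.le (norm_nonneg (r - q))
  rw [Real.norm_eq_abs, abs_le]
  simp only [inner_sub_left, inner_sub_right] at *
  rw [real_inner_comm (x r) r, real_inner_comm (x q) r, real_inner_comm (x r) q,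
    real_inner_comm (x q) q] at *
  constructor <;> linarith

theorem injective_of_isMinimizer [CompleteSpace E] (hd : Differentiable ℝ f)
    (hmin : ∀ q y, f (x q) + ⟪q, x q⟫ ≤ f y + ⟪q, y⟫) : Function.Injective x := by
  have hfoc (q : E) : fderiv ℝ f (x q) + innerSL ℝ q = 0 :=
    IsLocalMin.hasFDerivAt_eq_zero (f := fun y => f y + ⟪q, y⟫)
      (Eventually.of_forall (hmin q))
      ((hd (x q)).hasFDerivAt.add (innerSL ℝ q).hasFDerivAt)
  intro q r hqr
  have hq := hfoc q
  rw [hqr] at hq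
  exact innerSL_inj.1 (add_left_cancel (hq.trans (hfoc r).symm))

theorem concaveOn_optimalValue (hmin : ∀ q y, f (x q) + ⟪q, x q⟫ ≤ f y + ⟪q, y⟫) :
    ConcaveOn ℝ Set.univ fun q => f (x q) + ⟪q, x q⟫ := by
  refine ⟨convex_univ, fun q _ r _ a b ha hb hab => ?_⟩
  set y := x (a • q + b • r)
  have hq := mul_le_mul_of_nonneg_left (hmin q y) ha
  have hr := mul_le_mul_of_nonneg_left (hmin r y) hb
  have hy : f y = a * f y + b * f y := by rw [← add_mul, hab, one_mul]
  simp only [smul_eq_mul, inner_add_left, real_inner_smul_left]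
  linarith

end BestResponse

theorem tendsto_zero_of_hasDerivAt_le_neg {u u' : ℝ → ℝ} (hu : ∀ t, 0 ≤ t → HasDerivAt u (u' t) t)
    (hle : ∀ t, 0 ≤ t → u' t ≤ -u t) (hnonneg : ∀ t, 0 ≤ u t) :
    Tendsto u atTop (nhds 0) := by
  have hderiv (t : ℝ) (ht : 0 ≤ t) :
      HasDerivAt (fun t => Real.exp t * u t) (Real.exp t * u t + Real.exp t * u' t) t :=
    (Real.hasDerivAt_exp t).mul (hu t ht)
  have hanti : AntitoneOn (fun t => Real.exp t * u t) (Set.Ici 0) := by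
    refine antitoneOn_of_deriv_nonpos (convex_Ici 0)
      (fun t ht => (hderiv t ht).continuousAt.continuousWithinAt)
      (fun t ht => (hderiv t (interior_subset ht)).differentiableAt.differentiableWithinAt)
      fun t ht => ?_
    have ht₀ : 0 ≤ t := interior_subset ht
    rw [(hderiv t ht₀).deriv, ← mul_add]
    exact mul_nonpos_of_nonneg_of_nonpos (Real.exp_pos t).le (by linarith [hle t ht₀])
  refine squeeze_zero' (Eventually.of_forall hnonneg) (g := fun t => u 0 * Real.exp (-t)) ?_ ?_
  · filter_upwards [eventually_ge_atTop 0] with t ht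
    have hbound := hanti Set.self_mem_Ici ht ht
    simp only [Real.exp_zero, one_mul] at hbound
    rwa [Real.exp_neg, ← div_eq_mul_inv, le_div_iff₀' (Real.exp_pos t)]
  · simpa using Real.tendsto_exp_neg_atTop_nhds_zero.const_mul (u 0)

theorem tendsto_of_tendsto_convexOn {E α : Type*} [NormedAddCommGroup E] [NormedSpace ℝ E]
    [FiniteDimensional ℝ E] {V : E → ℝ} {x₀ : E} (hconv : ConvexOn ℝ Set.univ V)
    (hcont : Continuous V) (hmin : ∀ y, y ≠ x₀ → V x₀ < V y) {l : Filter α} {p : α → E}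
    (hp : Tendsto (fun t => V (p t)) l (nhds (V x₀))) : Tendsto p l (nhds x₀) := by
  refine Metric.tendsto_nhds.2 fun ε hε => ?_
  obtain ⟨c, hc, hgrow⟩ := hconv.exists_linear_growth hcont hmin hε
  filter_upwards [hp.eventually_lt_const (lt_add_of_pos_right (V x₀) (mul_pos hc hε))] with t ht
  by_contra! hfar
  rw [dist_eq_norm] at hfar
  have hle := mul_le_mul_of_nonneg_left hfar hc.le
  linarith [hgrow _ hfar]

/-- Theorem 2, case 2: each user `i` has a twice differentiable strictly convex local cost
`f_i` and responds to a price `p` by the unique minimizer `x*_i(p)` of `y ↦ f_i(y) + ⟨p, y⟩`,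
each response being decreasing in the monotone-operator sense; the aggregate cost `g` is
strictly convex and differentiable. Then the price dynamics
`ṗ = ∇g(Σ_i x*_i(p)) - p` converge to the equilibrium `p*`. -/
theorem price_dynamics_tendsto_equilibrium_bregman
    (T : ℕ) (hT : 1 ≤ T)
    (I : Type*) [Fintype I]
    (f : I → EuclideanSpace ℝ (Fin T) → ℝ)
    (hf2 : ∀ i, ContDiff ℝ 2 (f i))
    (hfconv : ∀ i, StrictConvexOn ℝ Set.univ (f i))
    (g : EuclideanSpace ℝ (Fin T) → ℝ)
    (hgconv : StrictConvexOn ℝ Set.univ g) (hgdiff : Differentiable ℝ g)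
    (xstar : I → EuclideanSpace ℝ (Fin T) → EuclideanSpace ℝ (Fin T))
    (hmin : ∀ (i : I) (q : EuclideanSpace ℝ (Fin T)),
      ∀ y : EuclideanSpace ℝ (Fin T), y ≠ xstar i q →
        f i (xstar i q) + ⟪q, xstar i q⟫ < f i y + ⟪q, y⟫)
    (hdec : ∀ (i : I) (q r : EuclideanSpace ℝ (Fin T)),
      ⟪xstar i q - xstar i r, q - r⟫ ≤ 0)
    (pstar : EuclideanSpace ℝ (Fin T))
    (hfix : gradient g (∑ i, xstar i pstar) = pstar)
    (p : ℝ → EuclideanSpace ℝ (Fin T)) (hdiff : Differentiable ℝ p)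
    (hode : ∀ t : ℝ, 0 ≤ t → deriv p t = gradient g (∑ i, xstar i (p t)) - p t) :
    Tendsto p atTop (nhds pstar) := by
  have hle (i : I) (q y : EuclideanSpace ℝ (Fin T)) :
      f i (xstar i q) + ⟪q, xstar i q⟫ ≤ f i y + ⟪q, y⟫ := by
    rcases eq_or_ne y (xstar i q) with rfl | hne
    · rfl
    · exact (hmin i q y hne).le
  have hfdiff (i : I) : Differentiable ℝ (f i) := (hf2 i).differentiable two_ne_zero
  have hxcont (i : I) : Continuous (xstar i) :=
    continuous_of_isStrictMinimizer (hfconv i).convexOn (hfdiff i).continuous (hmin i)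
  rcases isEmpty_or_nonempty I with hI | hI
  · refine tendsto_iff_norm_sub_tendsto_zero.2 ?_
    have hsq : Tendsto (fun t => ‖p t - pstar‖ ^ 2) atTop (nhds 0) := by
      refine tendsto_zero_of_hasDerivAt_le_neg
        (fun t _ => ((hdiff t).hasDerivAt.sub_const pstar).norm_sq) (fun t ht => ?_)
        fun t => sq_nonneg _
      have hderiv : deriv p t = -(p t - pstar) := by
        rw [hode t ht, ← hfix]
        simp
      rw [hderiv, inner_neg_right, real_inner_self_eq_norm_sq]
      linarith [sq_nonneg ‖p t - pstar‖]
    simpa using hsq.sqrt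
  set V : EuclideanSpace ℝ (Fin T) → ℝ := fun q =>
    ∑ i, (f i (xstar i pstar) + ⟪q, xstar i pstar⟫ - (f i (xstar i q) + ⟪q, xstar i q⟫)) with hV
  have hVstar : V pstar = 0 := by simp [hV]
  have hVnonneg (q : EuclideanSpace ℝ (Fin T)) : 0 ≤ V q :=
    Finset.sum_nonneg fun i _ => sub_nonneg.2 (hle i q _)
  have hVpos (q : EuclideanSpace ℝ (Fin T)) (hq : q ≠ pstar) : V pstar < V q := by
    rw [hVstar]
    refine Finset.sum_pos (fun i _ => sub_pos.2 (hmin i q _ fun he => hq ?_)) univ_nonempty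
    exact (injective_of_isMinimizer (hfdiff i) (hle i) he).symm
  have hVconv : ConvexOn ℝ Set.univ V := by
    have hsum (s : Finset I) : ConvexOn ℝ Set.univ fun q => ∑ i ∈ s,
        (f i (xstar i pstar) + ⟪q, xstar i pstar⟫ - (f i (xstar i q) + ⟪q, xstar i q⟫)) := by
      classical
      induction s using Finset.induction_on with
      | empty => simpa using convexOn_const (0 : ℝ) convex_univ
      | insert i s hi ih =>
        simp only [Finset.sum_insert hi]
        refine ConvexOn.add (ConvexOn.sub ?_ (concaveOn_optimalValue (hle i))) ih
        refine (convexOn_const _ convex_univ).add ?_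
        exact ((innerₛₗ ℝ (xstar i pstar)).convexOn convex_univ).congr
          fun q _ => real_inner_comm q (xstar i pstar)
    exact hsum univ
  have hVgrad (q : EuclideanSpace ℝ (Fin T)) : HasFDerivAt V
      (∑ i, (innerSL ℝ (xstar i pstar) - innerSL ℝ (xstar i q))) q := by
    refine HasFDerivAt.fun_sum fun i _ => HasFDerivAt.sub ?_
      (hasGradientAt_optimalValue (hxcont i) (hle i) q).hasFDerivAt
    simpa only [innerSL_apply_apply, real_inner_comm] using
      (innerSL ℝ (xstar i pstar)).hasFDerivAt.const_add (f i (xstar i pstar))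
  have hVcont : Continuous V :=
    continuous_iff_continuousAt.2 fun q => (hVgrad q).continuousAt
  refine tendsto_of_tendsto_convexOn hVconv hVcont hVpos ?_
  rw [hVstar]
  refine tendsto_zero_of_hasDerivAt_le_neg
    (fun t _ => (hVgrad (p t)).comp_hasDerivAt t (hdiff t).hasDerivAt) (fun t ht => ?_)
    fun t => hVnonneg _
  have hmono := hgconv.convexOn.inner_gradient_sub_nonneg hgdiff
    (∑ i, xstar i (p t)) (∑ i, xstar i pstar)
  have hVle : V (p t) ≤ ⟪∑ i, xstar i pstar - ∑ i, xstar i (p t), p t - pstar⟫ := by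
    rw [← Finset.sum_sub_distrib, sum_inner]
    refine Finset.sum_le_sum fun i _ => ?_
    have hopt := hle i pstar (xstar i (p t))
    rw [real_inner_comm (p t - pstar)]
    simp only [inner_sub_left, inner_sub_right]
    linarith
  have hderiv : (∑ i, (innerSL ℝ (xstar i pstar) - innerSL ℝ (xstar i (p t)))) (deriv p t)
      = ⟪∑ i, xstar i pstar - ∑ i, xstar i (p t), deriv p t⟫ := by
    rw [← Finset.sum_sub_distrib, sum_inner]
    simp [inner_sub_left]
  rw [hderiv, hode t ht]
  rw [hfix] at hmono
  simp only [inner_sub_left, inner_sub_right] at *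
  linarith
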